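/- arXiv:2402.06744 — 3 statements merged into one kernel-verified Lean document; each statement's English description precedes it below -/
import Mathlib

section
/- Let u ∈ C²([0,2π], ℝ). There exist constants C > 0 and ε₀ > 0 such that for every ε ∈ (0, ε₀): | (1/ε) ∫₀^{2π} ∫₀^{2π} ((u(y) − u(x))/ε)² · 1{|y − x| < ε} dy dx − (2/3) ∫₀^{2π} u'(x)² dx | ≤ C ε. -/
open MeasureTheory Filter Real Topology

theorem abs_sub_le_of_abs_deriv_le_on_Icc {f : ℝ → ℝ} (hf : Differentiable ℝ f) {a b M : ℝ}
    (hM : ∀ z ∈ Set.Icc a b, |deriv f z| ≤ M) {x y : ℝ}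
    (hx : x ∈ Set.Icc a b) (hy : y ∈ Set.Icc a b) : |f y - f x| ≤ M * |y - x| :=
  (convex_Icc a b).norm_image_sub_le_of_norm_deriv_le (fun z _ => hf z) hM hx hy

theorem abs_taylor_one_remainder_le {f : ℝ → ℝ} (hf : Differentiable ℝ f)
    (hf' : Differentiable ℝ (deriv f)) {a b M : ℝ}
    (hM : ∀ z ∈ Set.Icc a b, |deriv (deriv f) z| ≤ M) {x y : ℝ}
    (hx : x ∈ Set.Icc a b) (hy : y ∈ Set.Icc a b) :
    |f y - f x - deriv f x * (y - x)| ≤ M * |y - x| ^ 2 := by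
  have hM0 : 0 ≤ M := (abs_nonneg _).trans (hM x hx)
  have hd : ∀ z, HasDerivAt (fun z => f z - deriv f x * z) (deriv f z - deriv f x) z := fun z => by
    simpa [Pi.sub_def] using (hf z).hasDerivAt.sub ((hasDerivAt_id z).const_mul (deriv f x))
  have h := (convex_uIcc x y).norm_image_sub_le_of_norm_hasDerivWithin_le
    (C := M * |y - x|) (fun z _ => (hd z).hasDerivWithinAt) (fun z hz => by
      have hz' : z ∈ Set.Icc a b := Set.uIcc_subset_Icc hx hy hz
      exact (abs_sub_le_of_abs_deriv_le_on_Icc hf' hM hx hz').trans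
        (mul_le_mul_of_nonneg_left (Set.abs_sub_left_of_mem_uIcc hz) hM0)) Set.left_mem_uIcc Set.right_mem_uIcc
  rw [Real.norm_eq_abs, Real.norm_eq_abs] at h
  calc |f y - f x - deriv f x * (y - x)|
      = |f y - deriv f x * y - (f x - deriv f x * x)| := by ring_nf
    _ ≤ M * |y - x| * |y - x| := h
    _ = M * |y - x| ^ 2 := by ring

/-- Truncating the integrand to `|y - x| < ε` amounts to truncating the interval. -/
theorem integral_ite_abs_sub_lt (f : ℝ → ℝ) {L x ε : ℝ} (hx : x ∈ Set.Icc 0 L) (hε : 0 < ε) :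
    (∫ y in (0:ℝ)..L, if |y - x| < ε then f y else 0)
      = ∫ y in (max 0 (x - ε))..(min L (x + ε)), f y := by
  have hL : 0 ≤ L := hx.1.trans hx.2
  have hab : max 0 (x - ε) ≤ min L (x + ε) :=
    (max_le hx.1 (by linarith)).trans (le_min hx.2 (by linarith))
  have hind : (fun y => if |y - x| < ε then f y else 0)
      = (Set.Ioo (x - ε) (x + ε)).indicator f := by
    ext y
    simp only [Set.indicator, Set.mem_Ioo, abs_sub_lt_iff]
    congr 1
    apply propext
    constructor <;> rintro ⟨h₁, h₂⟩ <;> constructor <;> linarith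
  rw [hind, intervalIntegral.integral_of_le hL, intervalIntegral.integral_of_le hab,
    setIntegral_indicator measurableSet_Ioo, ← Set.Ioc_inter_Ioc]
  exact setIntegral_congr_set (ae_eq_set_inter (ae_eq_refl _) Ioo_ae_eq_Ioc)

theorem integral_sq_div_symm (d x : ℝ) {ε : ℝ} (hε : 0 < ε) :
    ∫ y in (x - ε)..(x + ε), (d * (y - x) / ε) ^ 2 = 2 / 3 * ε * d ^ 2 := by
  have h : ∀ y, (d * (y - x) / ε) ^ 2 = (d / ε) ^ 2 * (y - x) ^ 2 := fun y => by ring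
  simp_rw [h]
  rw [intervalIntegral.integral_const_mul,
    intervalIntegral.integral_comp_sub_right (fun z => z ^ 2) x, integral_pow]
  field_simp
  ring

section LocalEnergy

variable {u : ℝ → ℝ} {L M₁ M₂ : ℝ}

theorem abs_local_energy_le (hu : Differentiable ℝ u)
    (h₁ : ∀ z ∈ Set.Icc 0 L, |deriv u z| ≤ M₁) {x ε : ℝ} (hx : x ∈ Set.Icc 0 L) (hε : 0 < ε) :
    |∫ y in (0:ℝ)..L, if |y - x| < ε then ((u y - u x) / ε) ^ 2 else 0| ≤ 2 * M₁ ^ 2 * ε := by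
  have hab : max 0 (x - ε) ≤ min L (x + ε) :=
    (max_le hx.1 (by linarith)).trans (le_min hx.2 (by linarith))
  rw [integral_ite_abs_sub_lt (fun y => ((u y - u x) / ε) ^ 2) hx hε]
  rw [← Real.norm_eq_abs]
  refine (intervalIntegral.norm_integral_le_of_norm_le_const (C := M₁ ^ 2)
    fun y hy => ?_).trans ?_
  · rw [Set.uIoc_of_le hab] at hy
    have hy₁ := max_lt_iff.1 hy.1
    have hy₂ := le_min_iff.1 hy.2
    have hyx : |y - x| ≤ ε := abs_sub_le_iff.2 ⟨by linarith, by linarith⟩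
    have hM : 0 ≤ M₁ := (abs_nonneg _).trans (h₁ x hx)
    have h := abs_sub_le_of_abs_deriv_le_on_Icc hu h₁ hx ⟨hy₁.1.le, hy₂.1⟩
    rw [Real.norm_eq_abs, abs_pow, abs_div, abs_of_pos hε]
    gcongr
    rw [div_le_iff₀ hε]
    exact h.trans (by gcongr)
  · rw [abs_of_nonneg (sub_nonneg.2 hab)]
    have h : min L (x + ε) - max 0 (x - ε) ≤ 2 * ε := by
      linarith [min_le_right L (x + ε), le_max_right 0 (x - ε)]
    nlinarith [mul_le_mul_of_nonneg_left h (sq_nonneg M₁)]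

theorem abs_local_energy_sub_le_boundary (hu : Differentiable ℝ u)
    (h₁ : ∀ z ∈ Set.Icc 0 L, |deriv u z| ≤ M₁) {x ε : ℝ} (hx : x ∈ Set.Icc 0 L) (hε : 0 < ε) :
    |(∫ y in (0:ℝ)..L, if |y - x| < ε then ((u y - u x) / ε) ^ 2 else 0)
      - 2 / 3 * ε * deriv u x ^ 2| ≤ 3 * M₁ ^ 2 * ε := by
  have h := abs_local_energy_le hu h₁ hx hε
  have hsq : deriv u x ^ 2 ≤ M₁ ^ 2 := sq_le_sq.2 ((h₁ x hx).trans (le_abs_self _))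
  have hle : ε * deriv u x ^ 2 ≤ ε * M₁ ^ 2 := by gcongr
  have hnn : 0 ≤ ε * deriv u x ^ 2 := by positivity
  rw [abs_le] at h ⊢
  constructor <;> linarith [h.1, h.2]

theorem abs_local_energy_sub_le_interior (hu : Differentiable ℝ u)
    (hu' : Differentiable ℝ (deriv u))
    (h₁ : ∀ z ∈ Set.Icc 0 L, |deriv u z| ≤ M₁)
    (h₂ : ∀ z ∈ Set.Icc 0 L, |deriv (deriv u) z| ≤ M₂)
    {x ε : ℝ} (hε : 0 < ε) (hx : x ∈ Set.Icc ε (L - ε)) :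
    |(∫ y in (0:ℝ)..L, if |y - x| < ε then ((u y - u x) / ε) ^ 2 else 0)
      - 2 / 3 * ε * deriv u x ^ 2| ≤ 4 * M₁ * M₂ * ε ^ 2 := by
  have hx' : x ∈ Set.Icc 0 L := ⟨by linarith [hx.1], by linarith [hx.2]⟩
  have hM₁ : 0 ≤ M₁ := (abs_nonneg _).trans (h₁ x hx')
  have hM₂ : 0 ≤ M₂ := (abs_nonneg _).trans (h₂ x hx')
  have huc : Continuous u := hu.continuous
  rw [integral_ite_abs_sub_lt (fun y => ((u y - u x) / ε) ^ 2) hx' hε,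
    max_eq_right (by linarith [hx.1]), min_eq_right (by linarith [hx.2]),
    ← integral_sq_div_symm (deriv u x) x hε, ← intervalIntegral.integral_sub
      (Continuous.intervalIntegrable (by fun_prop) _ _)
      (Continuous.intervalIntegrable (by fun_prop) _ _)]
  rw [← Real.norm_eq_abs]
  refine (intervalIntegral.norm_integral_le_of_norm_le_const (C := 2 * M₁ * M₂ * ε)
    fun y hy => ?_).trans ?_
  · rw [Set.uIoc_of_le (by linarith)] at hy
    have hy' : y ∈ Set.Icc 0 L := ⟨by linarith [hy.1, hx.1], by linarith [hy.2, hx.2]⟩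
    have hyx : |y - x| ≤ ε := abs_sub_le_iff.2 ⟨by linarith [hy.2], by linarith [hy.1]⟩
    have hlip := abs_sub_le_of_abs_deriv_le_on_Icc hu h₁ hx' hy'
    have htay := abs_taylor_one_remainder_le hu hu' h₂ hx' hy'
    have hsum : |u y - u x + deriv u x * (y - x)| ≤ 2 * M₁ * ε := by
      refine (abs_add_le _ _).trans ?_
      rw [abs_mul]
      have hd : |deriv u x| * |y - x| ≤ M₁ * ε := by gcongr; exact h₁ x hx'
      have hl : M₁ * |y - x| ≤ M₁ * ε := by gcongr
      linarith
    have hdiff : |u y - u x - deriv u x * (y - x)| ≤ M₂ * ε ^ 2 := htay.trans (by gcongr)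
    have hfac : ((u y - u x) / ε) ^ 2 - (deriv u x * (y - x) / ε) ^ 2
        = (u y - u x - deriv u x * (y - x)) * (u y - u x + deriv u x * (y - x)) / ε ^ 2 := by
      ring
    rw [hfac, Real.norm_eq_abs, abs_div, abs_mul, abs_of_pos (pow_pos hε 2),
      div_le_iff₀ (pow_pos hε 2)]
    calc _ ≤ (M₂ * ε ^ 2) * (2 * M₁ * ε) := by gcongr
      _ = 2 * M₁ * M₂ * ε * ε ^ 2 := by ring
  · rw [show x + ε - (x - ε) = 2 * ε by ring, abs_of_pos (by linarith)]
    exact le_of_eq (by ring)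

theorem intervalIntegrable_local_energy (hu : Differentiable ℝ u) (hL : 0 ≤ L)
    (h₁ : ∀ z ∈ Set.Icc 0 L, |deriv u z| ≤ M₁) {ε : ℝ} (hε : 0 < ε) :
    IntervalIntegrable
      (fun x => ∫ y in (0:ℝ)..L, if |y - x| < ε then ((u y - u x) / ε) ^ 2 else 0)
      volume 0 L := by
  have huc : Continuous u := hu.continuous
  have hmeas : Measurable (Function.uncurry fun x y : ℝ =>
      if |y - x| < ε then ((u y - u x) / ε) ^ 2 else 0) := by
    refine Measurable.ite ?_ ?_ measurable_const
    · exact (isOpen_lt (f := fun p : ℝ × ℝ => |p.2 - p.1|) (by fun_prop)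
        continuous_const).measurableSet
    · exact (show Continuous fun p : ℝ × ℝ => ((u p.2 - u p.1) / ε) ^ 2 by fun_prop).measurable
  have hsm : StronglyMeasurable
      (fun x => ∫ y in (0:ℝ)..L, if |y - x| < ε then ((u y - u x) / ε) ^ 2 else 0) := by
    simp_rw [intervalIntegral.integral_of_le hL]
    exact hmeas.stronglyMeasurable.integral_prod_right
  refine (intervalIntegrable_const (c := 2 * M₁ ^ 2 * ε)).mono_fun
    hsm.aestronglyMeasurable ?_
  refine (ae_restrict_iff' measurableSet_uIoc).2 (ae_of_all _ fun x hx => ?_)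
  rw [Set.uIoc_of_le hL] at hx
  exact (abs_local_energy_le hu h₁ ⟨hx.1.le, hx.2⟩ hε).trans (le_abs_self _)

theorem abs_energy_sub_le (hu : Differentiable ℝ u) (hu' : Differentiable ℝ (deriv u))
    (h₁ : ∀ z ∈ Set.Icc 0 L, |deriv u z| ≤ M₁)
    (h₂ : ∀ z ∈ Set.Icc 0 L, |deriv (deriv u) z| ≤ M₂)
    {ε : ℝ} (hε : 0 < ε) (hεL : 2 * ε ≤ L) :
    |(1 / ε) * (∫ x in (0:ℝ)..L, ∫ y in (0:ℝ)..L,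
        if |y - x| < ε then ((u y - u x) / ε) ^ 2 else 0)
      - 2 / 3 * ∫ x in (0:ℝ)..L, deriv u x ^ 2| ≤ (6 * M₁ ^ 2 + 4 * M₁ * M₂ * L) * ε := by
  have hL : 0 ≤ L := by linarith
  have hM₁ : 0 ≤ M₁ := (abs_nonneg _).trans (h₁ 0 ⟨le_rfl, hL⟩)
  have hM₂ : 0 ≤ M₂ := (abs_nonneg _).trans (h₂ 0 ⟨le_rfl, hL⟩)
  have hint := intervalIntegrable_local_energy hu hL h₁ hε
  have hcont : Continuous fun x => 2 / 3 * ε * deriv u x ^ 2 := by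
    have := hu'.continuous
    fun_prop
  have hd := hcont.intervalIntegrable (μ := volume) 0 L
  set g : ℝ → ℝ := fun x => ∫ y in (0:ℝ)..L, if |y - x| < ε then ((u y - u x) / ε) ^ 2 else 0
  have hmem0 : (0:ℝ) ∈ Set.uIcc 0 L := Set.left_mem_uIcc
  have hmemL : L ∈ Set.uIcc 0 L := Set.right_mem_uIcc
  have hmem₁ : ε ∈ Set.uIcc 0 L := by rw [Set.uIcc_of_le hL]; constructor <;> linarith
  have hmem₂ : L - ε ∈ Set.uIcc 0 L := by rw [Set.uIcc_of_le hL]; constructor <;> linarith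
  have hh := hint.sub hd
  have hleft : |∫ x in (0:ℝ)..ε, (g x - 2 / 3 * ε * deriv u x ^ 2)| ≤ 3 * M₁ ^ 2 * ε * ε := by
    rw [← Real.norm_eq_abs]
    refine (intervalIntegral.norm_integral_le_of_norm_le_const fun x hx => ?_).trans_eq
      (by rw [sub_zero, abs_of_pos hε])
    rw [Set.uIoc_of_le hε.le] at hx
    exact abs_local_energy_sub_le_boundary hu h₁ ⟨hx.1.le, by linarith [hx.2]⟩ hε
  have hright : |∫ x in (L - ε)..L, (g x - 2 / 3 * ε * deriv u x ^ 2)| ≤ 3 * M₁ ^ 2 * ε * ε := by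
    rw [← Real.norm_eq_abs]
    refine (intervalIntegral.norm_integral_le_of_norm_le_const fun x hx => ?_).trans_eq
      (by rw [sub_sub_cancel, abs_of_pos hε])
    rw [Set.uIoc_of_le (by linarith)] at hx
    exact abs_local_energy_sub_le_boundary hu h₁ ⟨by linarith [hx.1], hx.2⟩ hε
  have hmid : |∫ x in ε..(L - ε), (g x - 2 / 3 * ε * deriv u x ^ 2)|
      ≤ 4 * M₁ * M₂ * ε ^ 2 * L := by
    rw [← Real.norm_eq_abs]
    refine (intervalIntegral.norm_integral_le_of_norm_le_const
      (C := 4 * M₁ * M₂ * ε ^ 2) fun x hx => ?_).trans ?_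
    · rw [Set.uIoc_of_le (by linarith)] at hx
      exact abs_local_energy_sub_le_interior hu hu' h₁ h₂ hε ⟨hx.1.le, hx.2⟩
    · gcongr
      rw [abs_of_nonneg (by linarith)]
      linarith
  have hsplit : ∫ x in (0:ℝ)..L, (g x - 2 / 3 * ε * deriv u x ^ 2)
      = (∫ x in (0:ℝ)..ε, (g x - 2 / 3 * ε * deriv u x ^ 2))
        + (∫ x in ε..(L - ε), (g x - 2 / 3 * ε * deriv u x ^ 2))
        + ∫ x in (L - ε)..L, (g x - 2 / 3 * ε * deriv u x ^ 2) := by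
    rw [intervalIntegral.integral_add_adjacent_intervals
        (hh.mono_set (Set.uIcc_subset_uIcc hmem0 hmem₁))
        (hh.mono_set (Set.uIcc_subset_uIcc hmem₁ hmem₂)),
      intervalIntegral.integral_add_adjacent_intervals
        (hh.mono_set (Set.uIcc_subset_uIcc hmem0 hmem₂))
        (hh.mono_set (Set.uIcc_subset_uIcc hmem₂ hmemL))]
  have hscale : (1 / ε) * (∫ x in (0:ℝ)..L, g x) - 2 / 3 * ∫ x in (0:ℝ)..L, deriv u x ^ 2
      = (∫ x in (0:ℝ)..L, (g x - 2 / 3 * ε * deriv u x ^ 2)) / ε := by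
    rw [intervalIntegral.integral_sub hint hd, intervalIntegral.integral_const_mul]
    field_simp
  rw [hscale, hsplit, abs_div, abs_of_pos hε, div_le_iff₀ hε]
  refine (abs_add_three _ _ _).trans ?_
  linarith

end LocalEnergy

/-- For `u ∈ C²([0,2π],ℝ)` there exist `C > 0` and `ε₀ > 0`
such that for every `ε ∈ (0, ε₀)`:
`| (1/ε) ∫₀^{2π} ∫₀^{2π} ((u(y) − u(x))/ε)² 1{|y−x|<ε} dy dx − (2/3) ∫₀^{2π} u'(x)² dx | ≤ C ε`. -/
theorem quadratic_energy_first_order_expansion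
    (u : ℝ → ℝ) (hu : ContDiff ℝ 2 u) :
    ∃ C > (0:ℝ), ∃ ε₀ > (0:ℝ), ∀ ε : ℝ, 0 < ε → ε < ε₀ →
      |(1 / ε) * (∫ x in (0:ℝ)..(2 * π), ∫ y in (0:ℝ)..(2 * π),
            (if |y - x| < ε then ((u y - u x) / ε) ^ 2 else 0))
          - 2 / 3 * ∫ x in (0:ℝ)..(2 * π), deriv u x ^ 2| ≤ C * ε := by
  have hd : Differentiable ℝ u := hu.differentiable (by norm_num)
  have hu' : ContDiff ℝ 1 (deriv u) :=
    ((contDiff_succ_iff_deriv (n := 1)).1 (by simpa [one_add_one_eq_two] using hu)).2.2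
  have hd' : Differentiable ℝ (deriv u) := hu'.differentiable (by norm_num)
  have hc' : Continuous (deriv (deriv u)) := hu'.continuous_deriv le_rfl
  obtain ⟨M₁, h₁⟩ := (isCompact_Icc (a := (0:ℝ)) (b := 2 * π)).exists_bound_of_continuousOn
    hd'.continuous.continuousOn
  obtain ⟨M₂, h₂⟩ := (isCompact_Icc (a := (0:ℝ)) (b := 2 * π)).exists_bound_of_continuousOn
    hc'.continuousOn
  have h0 : (0:ℝ) ∈ Set.Icc 0 (2 * π) := ⟨le_rfl, by positivity⟩
  have hM₁ : 0 ≤ M₁ := (norm_nonneg _).trans (h₁ 0 h0)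
  have hM₂ : 0 ≤ M₂ := (norm_nonneg _).trans (h₂ 0 h0)
  refine ⟨6 * M₁ ^ 2 + 4 * M₁ * M₂ * (2 * π) + 1, by positivity, π, pi_pos, fun ε hε hεπ => ?_⟩
  refine (abs_energy_sub_le hd hd' h₁ h₂ hε (by linarith)).trans ?_
  exact mul_le_mul_of_nonneg_right (by linarith) hε.le
end

section
/- lim_{ε→0⁺} (1/ε) ∫₀^{2π} ∫₀^{2π} ((1 − cos(u(y) − u(x)))/ε²) · 1{d(e^{ix}, e^{iy}) < ε} dy dx = (1/3) ∫₀^{2π} u'(x)² dx. -/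
open MeasureTheory Filter Real Topology

/-- Geodesic distance between two points of the circle given by their angles. -/
noncomputable def circleDist (x y : ℝ) : ℝ := ‖(↑(x - y) : AddCircle (2 * π))‖

lemma circleDist_le_abs_sub (x y : ℝ) : circleDist x y ≤ |x - y| :=
  QuotientAddGroup.norm_mk_le_norm

lemma exists_circleDist_eq {x y : ℝ} (hx : x ∈ Set.Icc 0 (2 * π)) (hy : y ∈ Set.Icc 0 (2 * π)) :
    circleDist x y = |x - y| ∨ circleDist x y = |x - (y + 2 * π)| ∨
      circleDist x y = |x - (y - 2 * π)| := by
  have hp : 0 < 2 * π := by positivity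
  set a := (2 * π)⁻¹ * (x - y) with ha
  have hxy : x - y = a * (2 * π) := by rw [ha]; field_simp
  have hcd : circleDist x y = |x - y - round a * (2 * π)| := by
    rw [circleDist, AddCircle.norm_eq]
  have h1 : |a| ≤ 1 := by
    rw [abs_le]
    constructor <;> nlinarith [hx.1, hx.2, hy.1, hy.2]
  have h2 := abs_sub_round a
  have h3 : round a = 0 ∨ round a = 1 ∨ round a = -1 := by
    rw [abs_le] at h1 h2
    have l : (-2 : ℝ) < round a := by linarith
    have r : (round a : ℝ) < 2 := by linarith
    have l' : -2 < round a := by exact_mod_cast l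
    have r' : round a < 2 := by exact_mod_cast r
    omega
  rcases h3 with h | h | h <;> rw [h] at hcd
  · left; rw [hcd]; simp
  · right; left; rw [hcd]; congr 1; push_cast; ring
  · right; right; rw [hcd]; congr 1; push_cast; ring

lemma circleDist_lt_iff {x y ε : ℝ} (hx : x ∈ Set.Ioo 0 (2 * π)) (hy : y ∈ Set.Icc 0 (2 * π))
    (h0 : ε < x) (h1 : ε < 2 * π - x) : circleDist x y < ε ↔ |x - y| < ε := by
  refine ⟨fun h => ?_, (circleDist_le_abs_sub x y).trans_lt⟩
  rcases exists_circleDist_eq (Set.Ioo_subset_Icc_self hx) hy with e | e | e <;> rw [e] at h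
  · exact h
  · rw [abs_lt] at h; linarith [hy.1, h.1]
  · rw [abs_lt] at h; linarith [hy.2, h.2]

lemma continuous_circleDist : Continuous fun p : ℝ × ℝ => circleDist p.1 p.2 :=
  continuous_norm.comp ((AddCircle.continuous_mk' (2 * π)).comp (continuous_fst.sub continuous_snd))

lemma measureReal_circleDist_lt_le {x ε : ℝ} (hx : x ∈ Set.Icc 0 (2 * π)) (hε : 0 < ε) :
    volume.real (Set.Ioc 0 (2 * π) ∩ {y | circleDist x y < ε}) ≤ 6 * ε := by
  have hsub : Set.Ioc 0 (2 * π) ∩ {y | circleDist x y < ε} ⊆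
      Metric.ball x ε ∪ (Metric.ball (x - 2 * π) ε ∪ Metric.ball (x + 2 * π) ε) := by
    rintro y ⟨hy, h⟩
    simp only [Set.mem_ofPred_eq] at h
    simp only [Set.mem_union, Metric.mem_ball', Real.dist_eq]
    rcases exists_circleDist_eq hx (Set.Ioc_subset_Icc_self hy) with e | e | e <;> rw [e] at h
    · exact Or.inl h
    · right; left; convert h using 2; ring
    · right; right; convert h using 2; ring
  calc _ ≤ volume.real (Metric.ball x ε ∪ (Metric.ball (x - 2 * π) ε ∪ Metric.ball (x + 2 * π) ε)) :=
        measureReal_mono hsub (by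
          refine (measure_union_lt_top measure_ball_lt_top
            (measure_union_lt_top measure_ball_lt_top measure_ball_lt_top)).ne)
    _ ≤ volume.real (Metric.ball x ε) +
          (volume.real (Metric.ball (x - 2 * π) ε) + volume.real (Metric.ball (x + 2 * π) ε)) :=
        (measureReal_union_le _ _).trans (by gcongr; exact measureReal_union_le _ _)
    _ = 6 * ε := by
        simp only [Real.volume_real_ball hε.le]; ring

lemma one_sub_cos_le_circleDist_sq {u : ℝ → ℝ} {L : ℝ}
    (hL : ∀ x ∈ Set.Icc 0 (2 * π), ∀ y ∈ Set.Icc 0 (2 * π), |u y - u x| ≤ L * |y - x|)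
    (huper : ∃ k : ℤ, u (2 * π) - u 0 = 2 * π * k)
    {x y : ℝ} (hx : x ∈ Set.Icc 0 (2 * π)) (hy : y ∈ Set.Icc 0 (2 * π)) :
    1 - Real.cos (u y - u x) ≤ (L * circleDist x y) ^ 2 / 2 := by
  have hp : 0 < 2 * π := by positivity
  have h0 : (0 : ℝ) ∈ Set.Icc 0 (2 * π) := ⟨le_rfl, hp.le⟩
  have h2 : (2 * π) ∈ Set.Icc 0 (2 * π) := ⟨hp.le, le_rfl⟩
  obtain ⟨k, hk⟩ := huper
  have key : ∀ w : ℝ, |w| ≤ L * circleDist x y → 1 - Real.cos w ≤ (L * circleDist x y) ^ 2 / 2 := by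
    intro w hw
    have h1 := Real.one_sub_sq_div_two_le_cos (x := w)
    have h2 := sq_le_sq' (abs_le.1 hw).1 (abs_le.1 hw).2
    linarith
  rcases exists_circleDist_eq hx hy with e | e | e
  · apply key
    rw [e, abs_sub_comm x y]
    exact hL x hx y hy
  · rw [← Real.cos_add_int_mul_two_pi _ k]
    apply key
    have a := hL 0 h0 y hy
    have b := hL x hx (2 * π) h2
    rw [e, abs_sub_comm, abs_of_nonneg (by linarith [hy.1, hx.2] : 0 ≤ y + 2 * π - x)]
    rw [sub_zero, abs_of_nonneg hy.1] at a
    rw [abs_of_nonneg (by linarith [hx.2] : 0 ≤ 2 * π - x)] at b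
    rw [abs_le] at a b ⊢
    constructor <;> nlinarith
  · rw [← Real.cos_sub_int_mul_two_pi _ k]
    apply key
    have a := hL (2 * π) h2 y hy
    have b := hL x hx 0 h0
    rw [e, abs_of_nonneg (by linarith [hy.2, hx.1] : 0 ≤ x - (y - 2 * π))]
    rw [abs_sub_comm y, abs_of_nonneg (by linarith [hy.2] : 0 ≤ 2 * π - y)] at a
    rw [zero_sub, abs_neg, abs_of_nonneg hx.1] at b
    rw [abs_le] at a b ⊢
    constructor <;> nlinarith

lemma intervalIntegral_ite_circleDist (g : ℝ → ℝ) (x ε : ℝ) :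
    (∫ y in (0 : ℝ)..(2 * π), if circleDist x y < ε then g y else 0) =
      ∫ y in Set.Ioc 0 (2 * π) ∩ {y | circleDist x y < ε}, g y := by
  have hm : MeasurableSet {y | circleDist x y < ε} :=
    (isOpen_lt (continuous_circleDist.comp (Continuous.prodMk_right x)) continuous_const).measurableSet
  rw [intervalIntegral.integral_of_le (by positivity), ← setIntegral_indicator hm]
  rfl

lemma intervalIntegral_ite_circleDist_eq_rescaled (g : ℝ → ℝ) {x ε : ℝ}
    (hx : x ∈ Set.Ioo 0 (2 * π)) (hε : 0 < ε) (h0 : ε < x) (h1 : ε < 2 * π - x) :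
    (1 / ε) * (∫ y in (0 : ℝ)..(2 * π), if circleDist x y < ε then g y else 0) =
      ∫ s in (-1 : ℝ)..1, g (x + ε * s) := by
  have hset : Set.Ioc 0 (2 * π) ∩ {y | circleDist x y < ε} = Set.Ioo (x - ε) (x + ε) := by
    ext y
    constructor
    · rintro ⟨hy, h⟩
      have := abs_lt.1 ((circleDist_lt_iff hx (Set.Ioc_subset_Icc_self hy) h0 h1).1 h)
      exact ⟨by linarith [this.2], by linarith [this.1]⟩
    · rintro ⟨ha, hb⟩
      refine ⟨⟨by linarith, by linarith⟩, (circleDist_le_abs_sub x y).trans_lt ?_⟩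
      rw [abs_lt]
      constructor <;> linarith
  rw [intervalIntegral_ite_circleDist, hset, ← integral_Ioc_eq_integral_Ioo,
    ← intervalIntegral.integral_of_le (by linarith),
    intervalIntegral.integral_comp_add_mul (fun y => g y) hε.ne' x, smul_eq_mul, one_div]
  congr 2 <;> ring

lemma tendsto_one_sub_cos_div_sq {u : ℝ → ℝ} {x : ℝ} (hu : DifferentiableAt ℝ u x) (s : ℝ) :
    Tendsto (fun ε : ℝ => (1 - Real.cos (u (x + ε * s) - u x)) / ε ^ 2) (𝓝[>] 0)
      (𝓝 (deriv u x ^ 2 * s ^ 2 / 2)) := by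
  have hlin : HasDerivAt (fun ε : ℝ => x + ε * s) s 0 := by
    simpa using ((hasDerivAt_id (0 : ℝ)).mul_const s).const_add x
  have hcomp : HasDerivAt (fun ε : ℝ => u (x + ε * s)) (deriv u x * s) 0 := by
    have hx : HasDerivAt u (deriv u x) (x + 0 * s) := by simpa using hu.hasDerivAt
    exact hx.comp (0 : ℝ) hlin
  have hsin : HasDerivAt (fun ε : ℝ => Real.sin ((u (x + ε * s) - u x) / 2))
      (deriv u x * s / 2) 0 := by
    simpa using ((hcomp.sub_const (u x)).div_const 2).sin
  have hslope := (hasDerivAt_iff_tendsto_slope_zero.1 hsin).mono_left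
    (nhdsGT_le_nhdsNE 0)
  have hsq := (hslope.pow 2).const_mul 2
  convert hsq using 2 with ε
  · simp only [zero_add, zero_mul, add_zero, sub_self, zero_div, Real.sin_zero, sub_zero,
      smul_eq_mul, mul_pow, Real.sin_sq_eq_half_sub]
    rw [show 2 * ((u (x + ε * s) - u x) / 2) = u (x + ε * s) - u x by ring]
    ring
  · ring

lemma tendsto_inner_integral {u : ℝ → ℝ} (hu : Differentiable ℝ u) {L : ℝ}
    (hL : ∀ x ∈ Set.Icc 0 (2 * π), ∀ y ∈ Set.Icc 0 (2 * π), |u y - u x| ≤ L * |y - x|)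
    {x : ℝ} (hx : x ∈ Set.Ioo 0 (2 * π)) :
    Tendsto (fun ε : ℝ => (1 / ε) * ∫ y in (0 : ℝ)..(2 * π),
        if circleDist x y < ε then (1 - Real.cos (u y - u x)) / ε ^ 2 else 0)
      (𝓝[>] 0) (𝓝 (1 / 3 * deriv u x ^ 2)) := by
  have hev : ∀ᶠ ε : ℝ in 𝓝[>] 0, 0 < ε ∧ ε < x ∧ ε < 2 * π - x := by
    filter_upwards [self_mem_nhdsWithin, nhdsWithin_le_nhds (Iio_mem_nhds hx.1),
      nhdsWithin_le_nhds (Iio_mem_nhds (sub_pos.2 hx.2))] with ε h0 h1 h2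
    exact ⟨h0, h1, h2⟩
  have hlim : Tendsto (fun ε : ℝ => ∫ s in (-1 : ℝ)..1,
      (1 - Real.cos (u (x + ε * s) - u x)) / ε ^ 2) (𝓝[>] 0)
      (𝓝 (∫ s in (-1 : ℝ)..1, deriv u x ^ 2 * s ^ 2 / 2)) := by
    refine intervalIntegral.tendsto_integral_filter_of_dominated_convergence
      (fun _ => L ^ 2 / 2) ?_ ?_ intervalIntegrable_const
      (Eventually.of_forall fun s _ => tendsto_one_sub_cos_div_sq (hu x) s)
    · refine Eventually.of_forall fun ε => Continuous.aestronglyMeasurable ?_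
      have := hu.continuous
      fun_prop
    · filter_upwards [hev] with ε ⟨h0, h1, h2⟩
      refine Eventually.of_forall fun s hs => ?_
      rw [Set.uIoc_of_le (by norm_num)] at hs
      have hs1 : |s| ≤ 1 := abs_le.2 ⟨hs.1.le, hs.2⟩
      have hb := hL x (Set.Ioo_subset_Icc_self hx) (x + ε * s)
        ⟨by nlinarith [hs.1], by nlinarith [hs.2]⟩
      rw [add_sub_cancel_left, abs_mul, abs_of_pos h0] at hb
      have hsq := sq_le_sq' (abs_le.1 hb).1 (abs_le.1 hb).2
      have hs2 : |s| ^ 2 ≤ 1 := pow_le_one₀ (abs_nonneg s) hs1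
      have hcos := Real.one_sub_sq_div_two_le_cos (x := u (x + ε * s) - u x)
      have hle : (L * (ε * |s|)) ^ 2 ≤ L ^ 2 * ε ^ 2 := by
        nlinarith [mul_le_mul_of_nonneg_left hs2 (by positivity : 0 ≤ L ^ 2 * ε ^ 2)]
      rw [Real.norm_of_nonneg (div_nonneg (sub_nonneg.2 (Real.cos_le_one _)) (sq_nonneg ε)),
        div_le_iff₀ (by positivity)]
      linarith
  have hval : (∫ s in (-1 : ℝ)..1, deriv u x ^ 2 * s ^ 2 / 2) = 1 / 3 * deriv u x ^ 2 := by
    rw [intervalIntegral.integral_div, intervalIntegral.integral_const_mul, integral_pow]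
    ring
  rw [← hval]
  refine hlim.congr' ?_
  filter_upwards [hev] with ε ⟨h0, h1, h2⟩
  exact (intervalIntegral_ite_circleDist_eq_rescaled
    (fun y => (1 - Real.cos (u y - u x)) / ε ^ 2) hx h0 h1 h2).symm

lemma norm_inner_integral_le {u : ℝ → ℝ} {L : ℝ}
    (hL : ∀ x ∈ Set.Icc 0 (2 * π), ∀ y ∈ Set.Icc 0 (2 * π), |u y - u x| ≤ L * |y - x|)
    (huper : ∃ k : ℤ, u (2 * π) - u 0 = 2 * π * k)
    {x ε : ℝ} (hx : x ∈ Set.Icc 0 (2 * π)) (hε : 0 < ε) :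
    ‖(1 / ε) * ∫ y in (0 : ℝ)..(2 * π),
        if circleDist x y < ε then (1 - Real.cos (u y - u x)) / ε ^ 2 else 0‖ ≤ 3 * L ^ 2 := by
  rw [intervalIntegral_ite_circleDist (fun y => (1 - Real.cos (u y - u x)) / ε ^ 2)]
  have hbound : ‖∫ y in Set.Ioc 0 (2 * π) ∩ {y | circleDist x y < ε},
      (1 - Real.cos (u y - u x)) / ε ^ 2‖ ≤
      L ^ 2 / 2 * volume.real (Set.Ioc 0 (2 * π) ∩ {y | circleDist x y < ε}) := by
    refine norm_setIntegral_le_of_norm_le_const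
      ((measure_mono Set.inter_subset_left).trans_lt measure_Ioc_lt_top) ?_
    rintro y ⟨hy, h⟩
    have hd : circleDist x y ^ 2 ≤ ε ^ 2 := pow_le_pow_left₀ (norm_nonneg _) (le_of_lt h) 2
    have hcos := one_sub_cos_le_circleDist_sq hL huper hx (Set.Ioc_subset_Icc_self hy)
    rw [Real.norm_of_nonneg (div_nonneg (sub_nonneg.2 (Real.cos_le_one _)) (sq_nonneg ε)),
      div_le_iff₀ (by positivity)]
    nlinarith [mul_le_mul_of_nonneg_left hd (sq_nonneg L)]
  have hvol := measureReal_circleDist_lt_le hx hε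
  rw [norm_mul, Real.norm_of_nonneg (by positivity), one_div, inv_mul_le_iff₀ hε]
  nlinarith [mul_le_mul_of_nonneg_left hvol (by positivity : 0 ≤ L ^ 2 / 2)]

lemma aestronglyMeasurable_inner_integral {u : ℝ → ℝ} (hu : Continuous u) (ε : ℝ)
    (μ : Measure ℝ) :
    AEStronglyMeasurable (fun x => (1 / ε) * ∫ y in (0 : ℝ)..(2 * π),
        if circleDist x y < ε then (1 - Real.cos (u y - u x)) / ε ^ 2 else 0) μ := by
  simp only [intervalIntegral.integral_of_le Real.two_pi_pos.le]
  refine (StronglyMeasurable.const_mul ?_ _).aestronglyMeasurable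
  refine StronglyMeasurable.integral_prod_right'
    (f := fun p : ℝ × ℝ => if circleDist p.1 p.2 < ε
      then (1 - Real.cos (u p.2 - u p.1)) / ε ^ 2 else 0) ?_
  refine StronglyMeasurable.ite
    (isOpen_lt continuous_circleDist continuous_const).measurableSet
    (Continuous.stronglyMeasurable ?_) stronglyMeasurable_const
  fun_prop

lemma exists_lipschitz_bound_Icc {u : ℝ → ℝ} (hu : ContDiff ℝ 1 u) (a b : ℝ) :
    ∃ L : ℝ, ∀ x ∈ Set.Icc a b, ∀ y ∈ Set.Icc a b, |u y - u x| ≤ L * |y - x| := by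
  obtain ⟨L, hL⟩ := isCompact_Icc.exists_bound_of_continuousOn (s := Set.Icc a b)
    (hu.continuous_deriv le_rfl).continuousOn
  exact ⟨L, fun x hx y hy => (convex_Icc a b).norm_image_sub_le_of_norm_deriv_le
    (fun z _ => hu.differentiable one_ne_zero z) hL hx hy⟩

/-- For a `C²` circle map `u`,
`lim_{ε→0⁺} (1/ε) ∫₀^{2π} ∫₀^{2π} ((1 − cos(u(y) − u(x)))/ε²) 1{d(e^{ix},e^{iy}) < ε} dy dx
  = (1/3) ∫₀^{2π} u'(x)² dx`. -/
theorem cosine_energy_limit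
    (u : ℝ → ℝ) (hu : ContDiff ℝ 2 u)
    (huper : ∃ k : ℤ, u (2 * π) - u 0 = 2 * π * k)
    (huper' : deriv u (2 * π) = deriv u 0)
    (huper'' : deriv (deriv u) (2 * π) = deriv (deriv u) 0) :
    Tendsto (fun ε : ℝ =>
        (1 / ε) * ∫ x in (0:ℝ)..(2 * π), ∫ y in (0:ℝ)..(2 * π),
          (if circleDist x y < ε then (1 - Real.cos (u y - u x)) / ε ^ 2 else 0))
      (𝓝[>] 0)
      (𝓝 (1 / 3 * ∫ x in (0:ℝ)..(2 * π), deriv u x ^ 2)) := by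
  have hu1 : ContDiff ℝ 1 u := hu.of_le one_le_two
  obtain ⟨L, hL⟩ := exists_lipschitz_bound_Icc hu1 0 (2 * π)
  refine Tendsto.congr (fun ε => intervalIntegral.integral_const_mul _ _) ?_
  rw [← intervalIntegral.integral_const_mul]
  refine intervalIntegral.tendsto_integral_filter_of_dominated_convergence
    (fun _ => 3 * L ^ 2)
    (Eventually.of_forall fun ε => aestronglyMeasurable_inner_integral hu.continuous ε _) ?_
    intervalIntegrable_const ?_
  · filter_upwards [self_mem_nhdsWithin] with ε hε
    refine Eventually.of_forall fun x hx => ?_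
    rw [Set.uIoc_of_le Real.two_pi_pos.le] at hx
    exact norm_inner_integral_le hL huper (Set.Ioc_subset_Icc_self hx) hε
  · filter_upwards [compl_mem_ae_iff.2 (measure_singleton (2 * π))] with x hne hx
    rw [Set.uIoc_of_le Real.two_pi_pos.le] at hx
    exact tendsto_inner_integral (hu1.differentiable one_ne_zero) hL
      ⟨hx.1, lt_of_le_of_ne hx.2 hne⟩
end

section
/- The index map I : 𝔻 → ℝ is continuous on 𝔻; since it is integer-valued, it is locally constant and hence constant on each connected component of 𝔻, and consequently each set K_q = {z ∈ 𝔻 : I(z) = q} is an open subset of (S¹)ⁿ. -/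
open Real

/-- Cyclic predecessor in `Fin n`. -/
def cpred {n : ℕ} (j : Fin n) : Fin n :=
  ⟨(j.1 + n - 1) % n, Nat.mod_lt _ (Nat.lt_of_le_of_lt (Nat.zero_le _) j.2)⟩

/-- The winding number (index) of a cyclic configuration of points on the circle:
`I(z) = (1/(2π)) ∑ⱼ θⱼ ⊖ θⱼ₋₁`, where `θⱼ ⊖ θⱼ₋₁ = arg (zⱼ / zⱼ₋₁) ∈ (-π, π)`. -/
noncomputable def windingIndex {n : ℕ} (z : Fin n → Circle) : ℝ :=
  (∑ j : Fin n, Complex.arg ((z j : ℂ) / (z (cpred j) : ℂ))) / (2 * π)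

/-- The set `𝔻` of configurations whose index is well defined. -/
def torusDom (n : ℕ) : Set (Fin n → Circle) :=
  {z | ∀ j : Fin n, (z j : ℂ) ≠ -((z (cpred j)) : ℂ)}

/-- `K_q`, the set of configurations with winding number `q`. -/
def Kset (n : ℕ) (q : ℤ) : Set (Fin n → Circle) :=
  {z | z ∈ torusDom n ∧ windingIndex z = (q : ℝ)}

theorem cpred_bijective (n : ℕ) : Function.Bijective (cpred (n := n)) := by
  refine Finite.injective_iff_bijective.mp fun a b h => ?_
  have hn : 0 < n := a.pos
  have h' : a.1 + (n - 1) ≡ b.1 + (n - 1) [MOD n] := by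
    simpa [cpred, Nat.ModEq, Nat.add_sub_assoc hn] using h
  exact Fin.ext ((Nat.ModEq.add_right_cancel' _ h').eq_of_lt_of_lt a.2 b.2)

theorem prod_div_cpred {n : ℕ} (z : Fin n → Circle) :
    ∏ j, ((z j : ℂ) / (z (cpred j) : ℂ)) = 1 := by
  rw [Finset.prod_div_distrib, (cpred_bijective n).prod_comp fun j => (z j : ℂ)]
  exact div_self (Finset.prod_ne_zero_iff.mpr fun j _ => Circle.coe_ne_zero _)

theorem exp_arg_div_circle (a b : Circle) :
    Complex.exp (Complex.arg ((a : ℂ) / b) * Complex.I) = (a : ℂ) / b := by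
  simpa [Circle.norm_coe] using Complex.norm_mul_exp_arg_mul_I ((a : ℂ) / b)

theorem exists_int_windingIndex_eq {n : ℕ} (z : Fin n → Circle) :
    ∃ m : ℤ, (m : ℝ) = windingIndex z := by
  have h : Complex.exp
      (((∑ j, Complex.arg ((z j : ℂ) / (z (cpred j) : ℂ)) : ℝ) : ℂ) * Complex.I) = 1 := by
    rw [Complex.ofReal_sum, Finset.sum_mul, Complex.exp_sum]
    simp_rw [exp_arg_div_circle]
    exact prod_div_cpred z
  obtain ⟨m, hm⟩ := Complex.exp_eq_one_iff.mp h
  refine ⟨m, ?_⟩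
  rw [← mul_assoc] at hm
  have hs : ∑ j, Complex.arg ((z j : ℂ) / (z (cpred j) : ℂ)) = m * (2 * π) := by
    exact_mod_cast mul_right_cancel₀ Complex.I_ne_zero hm
  rw [windingIndex, hs, mul_div_cancel_right₀ _ two_pi_pos.ne']

theorem div_mem_slitPlane_of_circle {a b : Circle} (h : (a : ℂ) ≠ -(b : ℂ)) :
    (a : ℂ) / b ∈ Complex.slitPlane := by
  rw [Complex.mem_slitPlane_iff_arg]
  refine ⟨fun harg => h ?_, div_ne_zero a.coe_ne_zero b.coe_ne_zero⟩
  have he := exp_arg_div_circle a b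
  rw [harg, Complex.exp_pi_mul_I, eq_div_iff b.coe_ne_zero] at he
  rw [← he, neg_one_mul]

theorem continuousOn_windingIndex (n : ℕ) :
    ContinuousOn (windingIndex (n := n)) (torusDom n) := by
  refine ContinuousOn.div_const (continuousOn_finsetSum _ fun j _ z hz => ?_) _
  refine ContinuousAt.continuousWithinAt ?_
  refine (Complex.continuousAt_arg (div_mem_slitPlane_of_circle (hz j))).comp
    (f := fun z : Fin n → Circle => (z j : ℂ) / (z (cpred j) : ℂ)) ?_
  exact ContinuousAt.div (Continuous.continuousAt (by fun_prop))
    (Continuous.continuousAt (by fun_prop)) (Circle.coe_ne_zero _)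

theorem isOpen_torusDom (n : ℕ) : IsOpen (torusDom n) := by
  rw [torusDom, Set.ofPred_forall]
  exact isOpen_iInter_of_finite fun j => isOpen_ne_fun (by fun_prop) (by fun_prop)

theorem isOpen_Kset (n : ℕ) (q : ℤ) : IsOpen (Kset n q) := by
  convert (continuousOn_windingIndex n).isOpen_inter_preimage (isOpen_torusDom n)
    (Metric.isOpen_ball (x := (q : ℝ)) (ε := 1)) using 1
  ext z
  refine and_congr_right fun _ => ?_
  obtain ⟨m, hm⟩ := exists_int_windingIndex_eq z
  rw [Set.mem_preimage, ← hm, Metric.mem_ball, Int.dist_cast_real, Int.dist_eq, Int.cast_inj]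
  norm_cast
  rw [Int.abs_lt_one_iff, sub_eq_zero]

/-- The index map `I : 𝔻 → ℝ` is continuous on `𝔻`; being
integer-valued, it is constant on every connected subset of `𝔻`, and
consequently each set `K_q` is an open subset of `(S¹)ⁿ`. -/
theorem windingIndex_continuousOn_and_Kset_open (n : ℕ) :
    ContinuousOn (windingIndex (n := n)) (torusDom n) ∧
      (∀ s : Set (Fin n → Circle), s ⊆ torusDom n → IsPreconnected s →
        ∀ z ∈ s, ∀ w ∈ s, windingIndex z = windingIndex w) ∧
      ∀ q : ℤ, IsOpen (Kset n q) := by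
  refine ⟨continuousOn_windingIndex n, fun s hs hconn z hz w hw => ?_, isOpen_Kset n⟩
  exact hconn.constant_of_mapsTo
    Int.isClosedEmbedding_coe_real.isInducing.isDiscrete_range
    ((continuousOn_windingIndex n).mono hs) (fun x _ => exists_int_windingIndex_eq x) hz hw
end
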